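/- arXiv:math/0507051 — 2 statements merged into one kernel-verified Lean document; each statement's English description precedes it below -/
import Mathlib

section
/- In ℂ[x,y], let s = √3 (the positive real square root of 3), and define f2 = 16962 + 43740y - 33924x - 9816s - 9816x^2 s - 25286ys - 15792y^2 s + 19632xs + 27445y^2 + 16962x^2, g2 = 6 + 6x^2 - 38y^2 + 9s + 9x^2 s - 11y^2 s + 16ys - 18xs - 12x + 3y, and h2 = -(-136995863187x^2 - 45018774416y^2 + 24984902205s + 80265133314x^2 s + 23477770096y^2 s + 49893109990ys - 23083475220xs + 36411797484xy + 35951630964x - 83905166058y - 41386138293 - 20817696276xys) / ((-3539 + 1787s)(7 + 4s)^4). Let g = f2^3 + g2^2 * h2. Then g is irreducible in ℂ[x,y], and there do not exist polynomials p, q ∈ ℂ[x,y] with total degree of p at most 2 and total degree of q at most 3 such that g = p^3 + q^2. -/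
open MvPolynomial

noncomputable section

def x : MvPolynomial (Fin 2) ℂ := X 0
def y : MvPolynomial (Fin 2) ℂ := X 1
def c (q : ℚ) : MvPolynomial (Fin 2) ℂ := C (q : ℂ)

/-- `s = √3`, as a constant polynomial. -/
def s : MvPolynomial (Fin 2) ℂ := C ((Real.sqrt 3 : ℝ) : ℂ)

def f2 : MvPolynomial (Fin 2) ℂ :=
  16962 + 43740 * y - 33924 * x - 9816 * s - 9816 * x ^ 2 * s - 25286 * y * s
    - 15792 * y ^ 2 * s + 19632 * x * s + 27445 * y ^ 2 + 16962 * x ^ 2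

def g2 : MvPolynomial (Fin 2) ℂ :=
  6 + 6 * x ^ 2 - 38 * y ^ 2 + 9 * s + 9 * x ^ 2 * s - 11 * y ^ 2 * s + 16 * y * s
    - 18 * x * s - 12 * x + 3 * y

/-- The scalar denominator `(-3539 + 1787 √3)(7 + 4 √3)^4`. -/
def d : ℂ := (((-3539 + 1787 * Real.sqrt 3) * (7 + 4 * Real.sqrt 3) ^ 4 : ℝ) : ℂ)

def h2 : MvPolynomial (Fin 2) ℂ :=
  - (C d⁻¹ *
    (-136995863187 * x ^ 2 - 45018774416 * y ^ 2 + 24984902205 * s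
      + 80265133314 * x ^ 2 * s + 23477770096 * y ^ 2 * s + 49893109990 * y * s
      - 23083475220 * x * s + 36411797484 * x * y + 35951630964 * x
      - 83905166058 * y - 41386138293 - 20817696276 * x * y * s))

/-- The sextic of semi-torus type with configuration `[A_11, 2A_2]`. -/
def g : MvPolynomial (Fin 2) ℂ := f2 ^ 3 + g2 ^ 2 * h2

lemma aux_cancel (F : ℂ → ℂ) (hF : Continuous F) (h : ∀ v, v ≠ 0 → F v = 0) : ∀ v, F v = 0 := by
  have := Continuous.ext_on (dense_compl_singleton (0:ℂ)) hF continuous_const (fun v hv => h v hv)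
  intro v; exact congrFun this v

lemma aux_homog (a : MvPolynomial (Fin 2) ℂ) (k : ℕ) (h : a.totalDegree ≤ k) :
    ∃ P : MvPolynomial (Fin 2) ℂ, P.totalDegree ≤ k ∧
      ∀ z w : ℂ, w ≠ 0 → w ^ k * eval ![1 + z / w, 1 / w] a = eval ![z, w] P := by
  refine ⟨∑ m ∈ a.support, C (a.coeff m) * ((X 0 + X 1) ^ (m 0) * X 1 ^ (k - m 0 - m 1)), ?_, ?_⟩
  · refine totalDegree_finsetSum_le fun m hm => ?_
    have hm' := (le_totalDegree hm).trans h
    have hs : (m.sum fun _ e => e) = m 0 + m 1 := by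
      rw [Finsupp.sum_fintype _ _ (by simp)]; simp [Fin.sum_univ_two]
    rw [hs] at hm'
    refine (totalDegree_mul _ _).trans ?_
    rw [totalDegree_C, zero_add]
    refine (totalDegree_mul _ _).trans ?_
    have h1 : ((X 0 + X 1 : MvPolynomial (Fin 2) ℂ) ^ (m 0)).totalDegree ≤ m 0 * 1 := by
      refine (totalDegree_pow _ _).trans (Nat.mul_le_mul_left _ ?_)
      refine (totalDegree_add _ _).trans ?_
      simp [totalDegree_X]
    have h2 : ((X 1 : MvPolynomial (Fin 2) ℂ) ^ (k - m 0 - m 1)).totalDegree ≤ (k - m 0 - m 1) := by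
      simp
    omega
  · intro z w hw
    rw [eval_eq', map_sum, Finset.mul_sum]
    refine Finset.sum_congr rfl fun m hm => ?_
    have hm' := (le_totalDegree hm).trans h
    have hs : (m.sum fun _ e => e) = m 0 + m 1 := by
      rw [Finsupp.sum_fintype _ _ (by simp)]; simp [Fin.sum_univ_two]
    rw [hs] at hm'
    obtain ⟨j, hj⟩ := Nat.exists_eq_add_of_le hm'
    have hk : k - m 0 - m 1 = j := by omega
    rw [hk, hj]
    simp [Fin.prod_univ_two]
    have : (1 + z / w) = (z + w) / w := by field_simp; ring
    rw [this, div_pow, pow_add, pow_add]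
    field_simp

lemma aux_coeffs (P : MvPolynomial (Fin 2) ℂ) (k : ℕ) (h : P.totalDegree ≤ k) :
    ∃ cc : ℕ → ℕ → ℂ, (∀ i j, k < i + j → cc i j = 0) ∧
      ∀ z w : ℂ, eval ![z, w] P =
        ∑ i ∈ Finset.range (k+1), ∑ j ∈ Finset.range (k+1), cc i j * (z ^ i * w ^ j) := by
  have hs : ∀ m : Fin 2 →₀ ℕ, (m.sum fun _ e => e) = m 0 + m 1 := by
    intro m
    rw [Finsupp.sum_fintype _ _ (by simp)]; simp [Fin.sum_univ_two]
  let e : ℕ × ℕ → (Fin 2 →₀ ℕ) := fun q => Finsupp.single 0 q.1 + Finsupp.single 1 q.2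
  have e0 : ∀ q, e q 0 = q.1 := by intro q; simp [e]
  have e1 : ∀ q, e q 1 = q.2 := by intro q; simp [e]
  refine ⟨fun i j => P.coeff (e (i, j)), ?_, ?_⟩
  · intro i j hij
    by_contra hne
    have := (le_totalDegree (mem_support_iff.mpr hne)).trans h
    rw [hs, e0, e1] at this
    simp at this
    omega
  · intro z w
    rw [eval_eq', ← Finset.sum_product']
    have hsub : P.support ⊆ (Finset.range (k+1) ×ˢ Finset.range (k+1)).image e := by
      intro m hm
      have := (le_totalDegree hm).trans h
      rw [hs] at this
      refine Finset.mem_image.mpr ⟨(m 0, m 1), ?_, ?_⟩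
      · simp; omega
      · ext i; fin_cases i
        · exact e0 _
        · exact e1 _
    rw [Finset.sum_subset hsub]
    · rw [Finset.sum_image]
      · refine Finset.sum_congr rfl fun q _ => ?_
        simp [Fin.prod_univ_two, e0, e1]
      · intro q _ q' _ hq
        ext
        · rw [← e0 q, ← e0 q']; exact congrArg (fun m => m 0) hq
        · rw [← e1 q, ← e1 q']; exact congrArg (fun m => m 1) hq
    · intro m _ hm
      rw [notMem_support_iff.mp hm]; simp

lemma aux_deg3 (P : MvPolynomial (Fin 2) ℂ) (h : P.totalDegree ≤ 3) :
    ∃ a00 a10 a01 a20 a11 a02 a30 a21 a12 a03 : ℂ, ∀ z w : ℂ, eval ![z, w] P =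
      a00 + a10*z + a01*w + a20*z^2 + a11*z*w + a02*w^2 + a30*z^3 + a21*z^2*w + a12*z*w^2 + a03*w^3 := by
  obtain ⟨cc, h0, h1⟩ := aux_coeffs P 3 h
  refine ⟨cc 0 0, cc 1 0, cc 0 1, cc 2 0, cc 1 1, cc 0 2, cc 3 0, cc 2 1, cc 1 2, cc 0 3, ?_⟩
  intro z w
  rw [h1]
  simp [Finset.sum_range_succ, h0 3 1, h0 3 2, h0 3 3, h0 2 2, h0 2 3, h0 1 3]
  ring

lemma aux_deg2 (P : MvPolynomial (Fin 2) ℂ) (h : P.totalDegree ≤ 2) :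
    ∃ a00 a10 a01 a20 a11 a02 : ℂ, ∀ z w : ℂ, eval ![z, w] P =
      a00 + a10*z + a01*w + a20*z^2 + a11*z*w + a02*w^2 := by
  obtain ⟨cc, h0, h1⟩ := aux_coeffs P 2 h
  refine ⟨cc 0 0, cc 1 0, cc 0 1, cc 2 0, cc 1 1, cc 0 2, ?_⟩
  intro z w
  rw [h1]
  simp [Finset.sum_range_succ, h0 1 2, h0 2 1, h0 2 2]
  ring

lemma aux_deg1 (P : MvPolynomial (Fin 2) ℂ) (h : P.totalDegree ≤ 1) :
    ∃ a00 a10 a01 : ℂ, ∀ z w : ℂ, eval ![z, w] P = a00 + a10*z + a01*w := by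
  obtain ⟨cc, h0, h1⟩ := aux_coeffs P 1 h
  refine ⟨cc 0 0, cc 1 0, cc 0 1, ?_⟩
  intro z w
  rw [h1]
  simp [Finset.sum_range_succ, h0 1 1]
  ring

lemma aux_poly6 (c0 c1 c2 c3 c4 c5 c6 : ℂ)
    (h : ∀ t : ℂ, c0 + c1*t + c2*t^2 + c3*t^3 + c4*t^4 + c5*t^5 + c6*t^6 = 0) :
    c0 = 0 ∧ c1 = 0 ∧ c2 = 0 ∧ c3 = 0 ∧ c4 = 0 ∧ c5 = 0 ∧ c6 = 0 := by
  have hp : (Polynomial.C c0 + Polynomial.C c1 * Polynomial.X + Polynomial.C c2 * Polynomial.X^2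
    + Polynomial.C c3 * Polynomial.X^3 + Polynomial.C c4 * Polynomial.X^4
    + Polynomial.C c5 * Polynomial.X^5 + Polynomial.C c6 * Polynomial.X^6 : Polynomial ℂ) = 0 := by
    apply Polynomial.funext; intro t; simpa using h t
  have H := fun n => congrArg (fun q => Polynomial.coeff q n) hp
  have H0 := H 0
  have H1 := H 1
  have H2 := H 2
  have H3 := H 3
  have H4 := H 4
  have H5 := H 5
  have H6 := H 6
  simp [Polynomial.coeff_X, Polynomial.coeff_C, Polynomial.coeff_X_pow] at H0 H1 H2 H3 H4 H5 H6
  exact ⟨H0, H1, H2, H3, H4, H5, H6⟩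

lemma aux_split3 (p r a : ℂ) (hp : p ≠ 0) (P : MvPolynomial (Fin 2) ℂ) (h : P.totalDegree ≤ 3)
    (hc : ∀ t, eval ![t, p*t^2+r] P = a) :
    ∃ l0 l1 l2 : ℂ, ∀ z w, eval ![z, w] P = a + (w - p*z^2 - r) * (l0 + l1*z + l2*w) := by
  obtain ⟨a00, a10, a01, a20, a11, a02, a30, a21, a12, a03, hP⟩ := aux_deg3 P h
  simp only [hP] at hc
  obtain ⟨H0, H1, H2, H3, H4, H5, H6⟩ := aux_poly6 (a00 + a01*r + a02*r^2 + a03*r^3 - a)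
    (a10 + a11*r + a12*r^2) (a20 + a01*p + 2*a02*p*r + a21*r + 3*a03*p*r^2)
    (a30 + a11*p + 2*a12*p*r) (a02*p^2 + a21*p + 3*a03*p^2*r) (a12*p^2) (a03*p^3)
    (fun t => by linear_combination hc t)
  have h03 : a03 = 0 := by simpa [hp] using H6
  have h12 : a12 = 0 := by simpa [hp] using H5
  subst h03 h12
  have h21 : a21 = -a02*p := by
    have : p * (a02*p + a21) = 0 := by linear_combination H4
    rcases mul_eq_zero.mp this with h | h
    · exact absurd h hp
    · linear_combination h
  subst h21
  refine ⟨a01 + r*a02, a11, a02, fun z w => ?_⟩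
  rw [hP]
  linear_combination H0 + z*H1 + z^2*H2 + z^3*H3

lemma aux_split2 (p r a : ℂ) (hp : p ≠ 0) (P : MvPolynomial (Fin 2) ℂ) (h : P.totalDegree ≤ 2)
    (hc : ∀ t, eval ![t, p*t^2+r] P = a) :
    ∃ l0 : ℂ, ∀ z w, eval ![z, w] P = a + (w - p*z^2 - r) * l0 := by
  obtain ⟨a00, a10, a01, a20, a11, a02, hP⟩ := aux_deg2 P h
  simp only [hP] at hc
  obtain ⟨H0, H1, H2, H3, H4, H5, H6⟩ := aux_poly6 (a00 + a01*r + a02*r^2 - a)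
    (a10 + a11*r) (a20 + a01*p + 2*a02*p*r)
    (a11*p) (a02*p^2) 0 0
    (fun t => by linear_combination hc t)
  have h02 : a02 = 0 := by simpa [hp] using H4
  have h11 : a11 = 0 := by simpa [hp] using H3
  subst h02 h11
  refine ⟨a01, fun z w => ?_⟩
  rw [hP]
  linear_combination H0 + z*H1 + z^2*H2

lemma aux_split1 (p r a : ℂ) (hp : p ≠ 0) (P : MvPolynomial (Fin 2) ℂ) (h : P.totalDegree ≤ 1)
    (hc : ∀ t, eval ![t, p*t^2+r] P = a) : ∀ z w, eval ![z, w] P = a := by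
  obtain ⟨a00, a10, a01, hP⟩ := aux_deg1 P h
  simp only [hP] at hc
  obtain ⟨H0, H1, H2, H3, H4, H5, H6⟩ := aux_poly6 (a00 + a01*r - a)
    a10 (a01*p) 0 0 0 0
    (fun t => by linear_combination hc t)
  have h01 : a01 = 0 := by simpa [hp] using H2
  subst h01
  intro z w
  rw [hP]
  linear_combination H0 + z*H1

/-- Restriction to the conic. -/
def restr (p r : ℂ) (P : MvPolynomial (Fin 2) ℂ) : Polynomial ℂ :=
  aeval ![Polynomial.X, Polynomial.C p * Polynomial.X ^ 2 + Polynomial.C r] P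

lemma restr_eval (p r t : ℂ) (P : MvPolynomial (Fin 2) ℂ) :
    (restr p r P).eval t = eval ![t, p*t^2+r] P := by
  have : ((Polynomial.evalRingHom t).comp
      (aeval ![Polynomial.X, Polynomial.C p * Polynomial.X ^ 2 + Polynomial.C r] :
        MvPolynomial (Fin 2) ℂ →ₐ[ℂ] Polynomial ℂ).toRingHom) = eval ![t, p*t^2+r] := by
    apply MvPolynomial.ringHom_ext
    · intro c; simp
    · intro i; fin_cases i <;> simp
  exact congrArg (fun f => f P) this

lemma aux_mul_const (A B : Polynomial ℂ) (k : ℂ) (hk : k ≠ 0) (h : ∀ t, A.eval t * B.eval t = k) :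
    ∃ a b, a * b = k ∧ (∀ t, A.eval t = a) ∧ ∀ t, B.eval t = b := by
  have hAB : A * B = Polynomial.C k := by apply Polynomial.funext; intro t; simpa using h t
  have hu : IsUnit (A * B) := by rw [hAB]; exact Polynomial.isUnit_C.mpr hk.isUnit
  obtain ⟨a, _, ha⟩ := Polynomial.isUnit_iff.mp (isUnit_of_mul_isUnit_left hu)
  obtain ⟨b, _, hb⟩ := Polynomial.isUnit_iff.mp (isUnit_of_mul_isUnit_right hu)
  have h0 := h 0
  refine ⟨a, b, ?_, ?_, ?_⟩
  · rw [← ha, ← hb] at h0; simpa using h0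
  · intro t; rw [← ha]; simp
  · intro t; rw [← hb]; simp

lemma aux_cat_const (A B : Polynomial ℂ) (k : ℂ) (hk : k ≠ 0)
    (h : ∀ t, A.eval t ^ 3 + B.eval t ^ 2 = k) :
    ∃ a b, a ^ 3 + b ^ 2 = k ∧ (∀ t, A.eval t = a) ∧ ∀ t, B.eval t = b := by
  have hAB : A ^ 3 + B ^ 2 = Polynomial.C k := by
    apply Polynomial.funext; intro t; simpa using h t
  suffices hd : A.natDegree = 0 ∧ B.natDegree = 0 by
    obtain ⟨a, ha⟩ := Polynomial.natDegree_eq_zero.mp hd.1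
    obtain ⟨b, hb⟩ := Polynomial.natDegree_eq_zero.mp hd.2
    have h0 := h 0
    refine ⟨a, b, ?_, ?_, ?_⟩
    · rw [← ha, ← hb] at h0; simpa using h0
    · intro t; rw [← ha]; simp
    · intro t; rw [← hb]; simp
  by_cases hA : A = 0
  · subst hA
    have := congrArg Polynomial.natDegree hAB
    simp at this
    simpa using this
  by_cases hB : B = 0
  · subst hB
    have := congrArg Polynomial.natDegree hAB
    simp at this
    simpa using this
  have hcop : IsCoprime A B := by
    refine ⟨Polynomial.C k⁻¹ * A^2, Polynomial.C k⁻¹ * B, ?_⟩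
    have : Polynomial.C k⁻¹ * Polynomial.C k = (1 : Polynomial ℂ) := by
      rw [← Polynomial.C_mul, inv_mul_cancel₀ hk, Polynomial.C_1]
    linear_combination Polynomial.C k⁻¹ * hAB + this
  have := Polynomial.flt_catalan (k := ℂ) (p := 3) (q := 2) (r := 6) (by norm_num) (by norm_num)
    (by norm_num) (by norm_num) (by norm_num) (by norm_num) (by norm_num) (a := A) (b := B) (c := 1)
    hA hB one_ne_zero hcop (u := 1) (v := 1) (w := -k) one_ne_zero one_ne_zero (neg_ne_zero.mpr hk)
    (by simp; linear_combination hAB)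
  exact ⟨this.1, this.2.1⟩

section Abstract

lemma aux_cubic (p r l m h0 h1 h2 h3 h4 h5 a b l0 l1 l2 m0 m1 m2 : ℂ) (hp : p ≠ 0) (hab : a * b = m^3)
    (h : ∀ z w : ℂ, (a + (w - p*z^2 - r) * (l0 + l1*z + l2*w)) * (b + (w - p*z^2 - r) * (m0 + m1*z + m2*w))
      = (l * (w - p*z^2 - r) + m)^3 + (w - p*z^2 - r)^2 * (h0 + h1*z + h2*w + h3*z^2 + h4*z*w + h5*w^2)) :
    ∀ z w : ℂ, (l0 + l1*z + l2*w) * (m0 + m1*z + m2*w) = (h0 - l^3*r + 3*l^2*m) + h1*z + (h2 + l^3)*w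
      + (h3 - l^3*p)*z^2 + h4*z*w + h5*w^2 := by
  have hA : ∀ z v : ℂ, a*(m0 + m1*z + m2*(v+p*z^2+r)) + b*(l0 + l1*z + l2*(v+p*z^2+r)) - 3*l*m^2
      + v*((l0 + l1*z + l2*(v+p*z^2+r)) * (m0 + m1*z + m2*(v+p*z^2+r)) - 3*l^2*m - l^3*v
        - (h0 + h1*z + h2*(v+p*z^2+r) + h3*z^2 + h4*z*(v+p*z^2+r) + h5*(v+p*z^2+r)^2)) = 0 := by
    intro z
    apply aux_cancel _ (by fun_prop)
    intro v hv
    apply mul_left_cancel₀ hv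
    linear_combination h z (v+p*z^2+r) - hab
  obtain ⟨H0, H1, H2, -⟩ := aux_poly6 (a*(m0+m2*r) + b*(l0+l2*r) - 3*l*m^2) (a*m1+b*l1) ((a*m2+b*l2)*p)
    0 0 0 0 (fun t => by linear_combination hA t 0)
  have H2' : a*m2+b*l2 = 0 := by simpa [hp] using H2
  have hB : ∀ z v : ℂ, (l0 + l1*z + l2*(v+p*z^2+r)) * (m0 + m1*z + m2*(v+p*z^2+r)) - 3*l^2*m - l^3*v
        - (h0 + h1*z + h2*(v+p*z^2+r) + h3*z^2 + h4*z*(v+p*z^2+r) + h5*(v+p*z^2+r)^2) = 0 := by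
    intro z
    apply aux_cancel _ (by fun_prop)
    intro v hv
    apply mul_left_cancel₀ hv
    linear_combination hA z v - H0 - z*H1 - (v+p*z^2)*H2'
  intro z w
  have := hB z (w - p*z^2-r)
  rw [show w - p*z^2-r + p*z^2+r = w by ring] at this
  linear_combination this

lemma aux_quad_eq (a0 a1 a2 a3 a4 a5 b0 b1 b2 b3 b4 b5 : ℂ)
    (h : ∀ z w : ℂ, a0 + a1*z + a2*w + a3*z^2 + a4*z*w + a5*w^2
      = b0 + b1*z + b2*w + b3*z^2 + b4*z*w + b5*w^2) :
    a0 = b0 ∧ a1 = b1 ∧ a2 = b2 ∧ a3 = b3 ∧ a4 = b4 ∧ a5 = b5 := by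
  have e00 := h 0 0
  have e10 := h 1 0
  have em0 := h (-1) 0
  have e01 := h 0 1
  have e0m := h 0 (-1)
  have e11 := h 1 1
  refine ⟨?_, ?_, ?_, ?_, ?_, ?_⟩
  · linear_combination e00
  · linear_combination (e10 - em0)/2
  · linear_combination (e01 - e0m)/2
  · linear_combination (e10 + em0)/2 - e00
  · linear_combination e11 - e10 - e01 + e00
  · linear_combination (e01 + e0m)/2 - e00

/-- determinant of the conic `a0 + a1 z + a2 w + a3 z² + a4 zw + a5 w²` (times 2) -/
def cdet (a0 a1 a2 a3 a4 a5 : ℂ) : ℂ :=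
  4*a0*a3*a5 + a1*a2*a4 - a0*a4^2 - a3*a2^2 - a5*a1^2

lemma aux_prod_det (a0 a1 a2 a3 a4 a5 l0 l1 l2 m0 m1 m2 : ℂ)
    (h : ∀ z w : ℂ, (l0 + l1*z + l2*w) * (m0 + m1*z + m2*w)
      = a0 + a1*z + a2*w + a3*z^2 + a4*z*w + a5*w^2) : cdet a0 a1 a2 a3 a4 a5 = 0 := by
  obtain ⟨e0, e1, e2, e3, e4, e5⟩ := aux_quad_eq (l0*m0) (l0*m1+l1*m0) (l0*m2+l2*m0) (l1*m1)
    (l1*m2+l2*m1) (l2*m2) a0 a1 a2 a3 a4 a5 (fun z w => by linear_combination h z w)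
  rw [← e0, ← e1, ← e2, ← e3, ← e4, ← e5, cdet]
  ring

lemma aux_torus (p r l m h0 h1 h2 h3 h4 h5 a b k l0 l1 l2 : ℂ) (hp : p ≠ 0) (hm : m ≠ 0) (hh5 : h5 ≠ 0)
    (hab : a^3 + b^2 = m^3)
    (h : ∀ z w : ℂ, (a + (w - p*z^2 - r) * k)^3 + (b + (w - p*z^2 - r) * (l0 + l1*z + l2*w))^2
      = (l * (w - p*z^2 - r) + m)^3 + (w - p*z^2 - r)^2 * (h0 + h1*z + h2*w + h3*z^2 + h4*z*w + h5*w^2)) :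
    4*h3*h5 = h4^2 := by
  have hA : ∀ z v : ℂ, 3*a^2*k + 2*b*(l0 + l1*z + l2*(v+p*z^2+r)) - 3*l*m^2
      + v*(3*a*k^2 + k^3*v + (l0 + l1*z + l2*(v+p*z^2+r))^2 - 3*l^2*m - l^3*v
        - (h0 + h1*z + h2*(v+p*z^2+r) + h3*z^2 + h4*z*(v+p*z^2+r) + h5*(v+p*z^2+r)^2)) = 0 := by
    intro z
    apply aux_cancel _ (by fun_prop)
    intro v hv
    apply mul_left_cancel₀ hv
    linear_combination h z (v+p*z^2+r) - hab
  obtain ⟨H0, H1, H2, -⟩ := aux_poly6 (3*a^2*k + 2*b*(l0+l2*r) - 3*l*m^2) (2*(b*l1)) (2*(b*l2)*p)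
    0 0 0 0 (fun t => by linear_combination hA t 0)
  replace H1 : b*l1 = 0 := by linear_combination H1/2
  have H2' : b*l2 = 0 := by
    apply mul_left_cancel₀ hp
    linear_combination H2/2
  have hB : ∀ z v : ℂ, 3*a*k^2 + k^3*v + (l0 + l1*z + l2*(v+p*z^2+r))^2 - 3*l^2*m - l^3*v
        - (h0 + h1*z + h2*(v+p*z^2+r) + h3*z^2 + h4*z*(v+p*z^2+r) + h5*(v+p*z^2+r)^2) = 0 := by
    intro z
    apply aux_cancel _ (by fun_prop)
    intro v hv
    apply mul_left_cancel₀ hv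
    linear_combination hA z v - H0 - 2*z*H1 - 2*(v+p*z^2)*H2'
  by_cases hb : b = 0
  · subst hb
    have ha3 : a^3 = m^3 := by linear_combination hab
    have hk : a^2*k = l*m^2 := by linear_combination H0/3
    have hk3 : k^3 = l^3 := by
      apply mul_left_cancel₀ (pow_ne_zero 6 hm)
      calc m^6*k^3 = (m^3)^2*k^3 := by ring
        _ = (a^2*k)^3 := by rw [← ha3]; ring
        _ = m^6*l^3 := by rw [hk]; ring
    have hak : a*k^2 = l^2*m := by
      apply mul_left_cancel₀ (pow_ne_zero 3 hm)
      calc m^3*(a*k^2) = (a^2*k)^2 := by rw [← ha3]; ring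
        _ = m^3*(l^2*m) := by rw [hk]; ring
    obtain ⟨e0, e1, e2, e3, e4, e5⟩ := aux_quad_eq (l0*l0) (l0*l1+l1*l0) (l0*l2+l2*l0) (l1*l1)
      (l1*l2+l2*l1) (l2*l2) h0 h1 h2 h3 h4 h5 (fun z w => by
        have := hB z (w - p*z^2-r)
        rw [show w - p*z^2-r + p*z^2+r = w by ring] at this
        linear_combination this - 3*hak - (w-p*z^2-r)*hk3)
    rw [← e3, ← e4, ← e5]; ring
  · have h1' : l1 = 0 := by simpa [hb] using H1
    have h2' : l2 = 0 := by simpa [hb] using H2'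
    subst h1' h2'
    exfalso
    have : h5 * p^2 = 0 := by
      linear_combination (-1/24)*(hB 2 0 - 4*hB 1 0 + 6*hB 0 0 - 4*hB (-1) 0 + hB (-2) 0)
    simp [hp, hh5] at this

end Abstract

section Abstract2

variable (G : MvPolynomial (Fin 2) ℂ) (p r l m h0 h1 h2 h3 h4 h5 : ℂ)

/-- the transformed sextic -/
def tsext (p r l m h0 h1 h2 h3 h4 h5 z w : ℂ) : ℂ :=
  (l * (w - p*z^2 - r) + m)^3 + (w - p*z^2 - r)^2 * (h0 + h1*z + h2*w + h3*z^2 + h4*z*w + h5*w^2)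

lemma aux_const_dvd (a : MvPolynomial (Fin 2) ℂ) (k : ℕ) (hk : k ≠ 0) (α : ℂ)
    (h : ∀ z w : ℂ, w ≠ 0 → w ^ k * eval ![1 + z / w, 1 / w] a = α) (u : ℂ) :
    eval ![u, 0] a = 0 := by
  have : ∀ y : ℂ, eval ![u, y] a - α * y^k = 0 := by
    apply aux_cancel
    · have : Continuous fun y : ℂ => eval ![u, y] a := by
        apply (MvPolynomial.continuous_eval a).comp
        apply continuous_pi; intro i; fin_cases i
        · exact continuous_const
        · exact continuous_id
      fun_prop
    · intro y hy
      have h1 := h ((u-1)*y⁻¹) y⁻¹ (inv_ne_zero hy)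
      have e : (1 + (u-1)*y⁻¹ / y⁻¹) = u := by field_simp; ring
      rw [e, one_div, inv_inv] at h1
      rw [← h1, inv_pow]
      field_simp
      simp
  simpa [hk] using this 0

/-- factor with small degree -/
lemma aux_factor (hp : p ≠ 0) (hm : m ≠ 0) (hh5 : h5 ≠ 0)
    (hdet : cdet (h0 - l^3*r + 3*l^2*m) h1 (h2 + l^3) (h3 - l^3*p) h4 h5 ≠ 0)
    (hG : ∀ z w : ℂ, w ≠ 0 → w^6 * eval ![1 + z/w, 1/w] G = tsext p r l m h0 h1 h2 h3 h4 h5 z w)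
    (hG0 : eval ![2, 0] G ≠ 0)
    (a b : MvPolynomial (Fin 2) ℂ) (hab : G = a * b) (ha : a.totalDegree ≤ 3)
    (hdeg : a.totalDegree + b.totalDegree ≤ 6) : IsUnit a := by
  obtain ⟨k, hk⟩ : ∃ k, k = a.totalDegree := ⟨_, rfl⟩
  rw [← hk] at ha hdeg
  obtain ⟨A, hA, hA'⟩ := aux_homog a k hk.ge
  obtain ⟨B, hB, hB'⟩ := aux_homog b (6-k) (by omega)
  have hAB : ∀ z w : ℂ, eval ![z, w] A * eval ![z, w] B = tsext p r l m h0 h1 h2 h3 h4 h5 z w := by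
    intro z
    have key : ∀ w, eval ![z, w] A * eval ![z, w] B - tsext p r l m h0 h1 h2 h3 h4 h5 z w = 0 := by
      apply aux_cancel
      · have hc : ∀ P : MvPolynomial (Fin 2) ℂ, Continuous fun y : ℂ => eval ![z, y] P := by
          intro P
          apply (MvPolynomial.continuous_eval P).comp
          apply continuous_pi; intro i; fin_cases i
          · exact continuous_const
          · exact continuous_id
        have := hc A
        have := hc B
        unfold tsext
        fun_prop
      · intro w hw
        rw [← hA' z w hw, ← hB' z w hw, ← hG z w hw, hab, map_mul]
        have : w^6 = w^k * w^(6-k) := by rw [← pow_add]; congr 1; omega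
        rw [this]; ring
    intro w; exact sub_eq_zero.mp (key w)
  obtain ⟨α, β, hαβ, hα, hβ⟩ := aux_mul_const (restr p r A) (restr p r B) (m^3) (pow_ne_zero 3 hm)
    (fun t => by rw [restr_eval, restr_eval, hAB, tsext]; ring)
  simp only [restr_eval] at hα hβ
  have hα0 : α ≠ 0 := by rintro rfl; rw [zero_mul] at hαβ; exact pow_ne_zero 3 hm hαβ.symm
  have hcon : ∀ α : ℂ, k ≠ 0 → (∀ z w, eval ![z, w] A = α) → False := by
    intro α hk0 h
    apply hG0
    rw [hab, map_mul, aux_const_dvd a k hk0 α (fun z w hw => by rw [hA' z w hw, h]) 2, zero_mul]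
  have hk4 : k = 0 ∨ k = 1 ∨ k = 2 ∨ k = 3 := by omega
  rcases hk4 with h | h | h | h
  · rw [h] at hk
    have := totalDegree_eq_zero_iff_eq_C.mp hk.symm
    have hne : a ≠ 0 := by rintro rfl; rw [zero_mul] at hab; simp [hab] at hG0
    rw [this] at hne ⊢
    apply IsUnit.map
    exact (by simpa using hne : coeff 0 a ≠ 0).isUnit
  · exact (hcon α (by omega) (aux_split1 p r α hp A (h ▸ hA) hα)).elim
  · obtain ⟨l0, hl⟩ := aux_split2 p r α hp A (h ▸ hA) hα
    by_cases h0' : l0 = 0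
    · exact (hcon α (by omega) (fun z w => by rw [hl, h0']; ring)).elim
    · exfalso
      have hz : ∀ z, tsext p r l m h0 h1 h2 h3 h4 h5 z (-α/l0 + p*z^2 + r) = 0 := by
        intro z
        rw [← hAB, hl]
        have : α + (-α/l0 + p*z^2 + r - p*z^2 - r)*l0 = 0 := by field_simp; ring
        rw [this, zero_mul]
      set v := -α/l0 with hv
      have hv0 : v ≠ 0 := by rw [hv]; simp [hα0, h0']
      have hz' : ∀ z, (l*v+m)^3 + v^2 * (h0 + h1*z + h2*(v+p*z^2+r) + h3*z^2 + h4*z*(v+p*z^2+r) + h5*(v+p*z^2+r)^2) = 0 := by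
        intro z
        have := hz z
        unfold tsext at this
        linear_combination this
      have : h5 * p^2 * v^2 = 0 := by
        linear_combination (1/24)*(hz' 2 - 4*hz' 1 + 6*hz' 0 - 4*hz' (-1) + hz' (-2))
      simp [hp, hh5, hv0] at this
  · obtain ⟨l0, l1, l2, hl⟩ := aux_split3 p r α hp A (h ▸ hA) hα
    obtain ⟨m0, m1, m2, hm'⟩ := aux_split3 p r β hp B (by rw [h] at hB; exact hB) hβ
    exfalso
    apply hdet
    apply aux_prod_det _ _ _ _ _ _ l0 l1 l2 m0 m1 m2
    apply aux_cubic p r l m h0 h1 h2 h3 h4 h5 α β l0 l1 l2 m0 m1 m2 hp hαβ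
    intro z w
    rw [← hl, ← hm', hAB, tsext]

lemma aux_nontorus (hp : p ≠ 0) (hm : m ≠ 0) (hh5 : h5 ≠ 0) (hmin : 4*h3*h5 ≠ h4^2)
    (hG : ∀ z w : ℂ, w ≠ 0 → w^6 * eval ![1 + z/w, 1/w] G = tsext p r l m h0 h1 h2 h3 h4 h5 z w)
    (a b : MvPolynomial (Fin 2) ℂ) (hab : G = a^3 + b^2) (ha : a.totalDegree ≤ 2)
    (hb : b.totalDegree ≤ 3) : False := by
  obtain ⟨A, hA, hA'⟩ := aux_homog a 2 ha
  obtain ⟨B, hB, hB'⟩ := aux_homog b 3 hb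
  have hAB : ∀ z w : ℂ, eval ![z, w] A ^ 3 + eval ![z, w] B ^ 2 = tsext p r l m h0 h1 h2 h3 h4 h5 z w := by
    intro z
    have key : ∀ w, eval ![z, w] A ^ 3 + eval ![z, w] B ^ 2 - tsext p r l m h0 h1 h2 h3 h4 h5 z w = 0 := by
      apply aux_cancel
      · have hc : ∀ P : MvPolynomial (Fin 2) ℂ, Continuous fun y : ℂ => eval ![z, y] P := by
          intro P
          apply (MvPolynomial.continuous_eval P).comp
          apply continuous_pi; intro i; fin_cases i
          · exact continuous_const
          · exact continuous_id
        have := hc A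
        have := hc B
        unfold tsext
        fun_prop
      · intro w hw
        rw [← hA' z w hw, ← hB' z w hw, ← hG z w hw, hab, map_add, map_pow, map_pow]
        ring
    intro w; exact sub_eq_zero.mp (key w)
  obtain ⟨α, β, hαβ, hα, hβ⟩ := aux_cat_const (restr p r A) (restr p r B) (m^3) (pow_ne_zero 3 hm)
    (fun t => by rw [restr_eval, restr_eval, hAB, tsext]; ring)
  simp only [restr_eval] at hα hβ
  obtain ⟨k, hk⟩ := aux_split2 p r α hp A hA hα
  obtain ⟨l0, l1, l2, hl⟩ := aux_split3 p r β hp B hB hβ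
  apply hmin
  apply aux_torus p r l m h0 h1 h2 h3 h4 h5 α β k l0 l1 l2 hp hm hh5 hαβ
  intro z w
  rw [← hk, ← hl, hAB, tsext]

end Abstract2

lemma aux_nz (a b t : ℂ) (ht : t^2 = 3) (h : a^2 - 3*b^2 ≠ 0) : a + b*t ≠ 0 := by
  intro h0
  apply h
  linear_combination (a - b*t)*h0 + b^2*ht

lemma aux_det (t : ℂ) (ht : t^2 = 3) : cdet (((-148424248730208) + (85692779816688)*t) - ((43740) + (-25286)*t)^3*((6/11) + (25/33)*t) + 3*((43740) + (-25286)*t)^2*((-6165) + (3552)*t))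
    (((125533817618472) + (-72476983382868)*t))
    (((-169505593735212) + (97864100265642)*t) + ((43740) + (-25286)*t)^3)
    (((-956262336550497/2) + (552098317555539/2)*t) - ((43740) + (-25286)*t)^3*((-6/11) + (-1/11)*t))
    (((-824727561711525) + (476156679763059)*t))
    (((-986499871021431/2) + (569555966082339/2)*t)) ≠ 0 := by
  have e0 : ((-148424248730208) + (85692779816688)*t) - ((43740) + (-25286)*t)^3*((6/11) + (25/33)*t) + 3*((43740) + (-25286)*t)^2*((-6165) + (3552)*t) = ((-32859580102668) + (18971487399744)*t) := by
    linear_combination ((720845586642980/11)*t^0 + (-527213768764128/11)*t^1 + (404185202341400/33)*t^2)*ht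
  have e2 : ((-169505593735212) + (97864100265642)*t) + ((43740) + (-25286)*t)^3 = ((165876269702148) + (-95768708976126)*t) := by
    linear_combination ((83899679271120)*t^0 + (-16167408093656)*t^1)*ht
  have e3 : ((-956262336550497/2) + (552098317555539/2)*t) - ((43740) + (-25286)*t)^3*((-6/11) + (-1/11)*t) = ((-696009108750705/2) + (401841046280403/2)*t) := by
    linear_combination ((309765266384952/11)*t^0 + (-13104769290816/11)*t^1 + (-16167408093656/11)*t^2)*ht
  rw [e0, e2, e3]
  have : cdet ((-32859580102668) + (18971487399744)*t) ((125533817618472) + (-72476983382868)*t) ((165876269702148) + (-95768708976126)*t) ((-696009108750705/2) + (401841046280403/2)*t) ((-824727561711525) + (476156679763059)*t) ((-986499871021431/2) + (569555966082339/2)*t) = (-146308316396562658422821500052411255802210) + (84471145856236387866515730740228575889190)*t := by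
    unfold cdet
    linear_combination ((-36577078861170987711155276018866480091094)*t^0 + (7039262017294508695968925235504399141514)*t^1)*ht
  rw [this]
  exact aux_nz _ _ t ht (by norm_num)

lemma aux_minor (t : ℂ) (ht : t^2 = 3) : 4*((-956262336550497/2) + (552098317555539/2)*t)*((-986499871021431/2) + (569555966082339/2)*t) ≠ ((-824727561711525) + (476156679763059)*t)^2 := by
  intro h
  have : (526354241457476287254678340302) + (-303890762994575211948316018842)*t = 0 := by
    linear_combination h - ((87725706944798676940498488240)*t^0)*ht
  exact aux_nz _ _ t ht (by norm_num) this

lemma aux_sq : (((Real.sqrt 3 : ℝ) : ℂ))^2 = 3 := by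
  have : (Real.sqrt 3)^2 = 3 := Real.sq_sqrt (by norm_num)
  exact_mod_cast this

lemma aux_dinv (t : ℂ) (ht : t = ((Real.sqrt 3 : ℝ) : ℂ)) : d⁻¹ = ((-8351459/2944414) + (4821717/2944414)*t) := by
  have h2 : t^2 = 3 := by rw [ht]; exact aux_sq
  have hd : d = ((-8351459) + (-4821717)*t) := by
    unfold d
    push_cast
    rw [← ht]
    linear_combination ((48560)*t^0 + (3436576)*t^1 + (2296320)*t^2 + (457472)*t^3)*h2
  rw [hd]
  apply inv_eq_of_mul_eq_one_right
  linear_combination ((-23248954828089/2944414)*t^0)*h2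


lemma aux_f2 (t z w : ℂ) (ht : t = ((Real.sqrt 3 : ℝ) : ℂ)) (hw : w ≠ 0) :
    w^2 * eval ![1 + z/w, 1/w] f2 = ((43740) + (-25286)*t)*(w - ((-6/11) + (-1/11)*t)*z^2 - ((6/11) + (25/33)*t)) + ((-6165) + (3552)*t) := by
  have h2 : t^2 = 3 := by rw [ht]; exact aux_sq
  simp only [f2, x, y, s, map_add, map_sub, map_mul, map_pow, eval_X, eval_C, map_ofNat, ← ht,
    Matrix.cons_val_zero, Matrix.cons_val_one]
  field_simp
  linear_combination 363*((25286/11)*z^2 + (-632150/33))*h2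

lemma aux_g2 (t z w : ℂ) (ht : t = ((Real.sqrt 3 : ℝ) : ℂ)) (hw : w ≠ 0) :
    w^2 * eval ![1 + z/w, 1/w] g2 = ((3) + (16)*t)*(w - ((-6/11) + (-1/11)*t)*z^2 - ((6/11) + (25/33)*t)) := by
  have h2 : t^2 = 3 := by rw [ht]; exact aux_sq
  simp only [g2, x, y, s, map_add, map_sub, map_mul, map_pow, eval_X, eval_C, map_ofNat, ← ht,
    Matrix.cons_val_zero, Matrix.cons_val_one]
  field_simp
  linear_combination 363*((-16/11)*z^2 + (400/33))*h2

lemma aux_h2 (t z w : ℂ) (ht : t = ((Real.sqrt 3 : ℝ) : ℂ)) (hw : w ≠ 0) :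
    ((3) + (16)*t)^2 * (w^2 * eval ![1 + z/w, 1/w] h2) = (((-148424248730208) + (85692779816688)*t) + ((125533817618472) + (-72476983382868)*t)*z + ((-169505593735212) + (97864100265642)*t)*w + ((-956262336550497/2) + (552098317555539/2)*t)*z^2 + ((-824727561711525) + (476156679763059)*t)*z*w + ((-986499871021431/2) + (569555966082339/2)*t)*w^2) := by
  have hs2 : t^2 = 3 := by rw [ht]; exact aux_sq
  simp only [h2, x, y, s, map_add, map_sub, map_mul, map_pow, eval_X, eval_C, map_ofNat, map_neg, ← ht,
    Matrix.cons_val_zero, Matrix.cons_val_one, aux_dinv t ht]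
  field_simp
  linear_combination 5888828*(((-6570283088815415176/133837)*t^0 + (4313486406879671552/133837)*t^1 + (-1317273171711707136/133837)*t^2)*(1) + ((61147784227506708834/1472207)*t^0 + (-39908368619464576320/1472207)*t^1 + (12848261124457714176/1472207)*t^2)*(z) + ((-82587482164751943429/1472207)*t^0 + (53663894651004183328/1472207)*t^1 + (-17944757323113848064/1472207)*t^2)*(w) + ((-232919844615802496397/1472207)*t^0 + (151776683940104915616/1472207)*t^1 + (-49538016999344657664/1472207)*t^2)*(z^2) + ((-401741256669120640440/1472207)*t^0 + (262031314409306293248/1472207)*t^1 + (-84829379933108164608/1472207)*t^2)*(z*w) + ((-480542167673125074207/2944414)*t^0 + (156723281357691800880/1472207)*t^1 + (-50711539280027313024/1472207)*t^2)*(w^2))*hs2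

lemma aux_g (t : ℂ) (ht : t = ((Real.sqrt 3 : ℝ) : ℂ)) (z w : ℂ) (hw : w ≠ 0) :
    w^6 * eval ![1 + z/w, 1/w] g = tsext ((-6/11) + (-1/11)*t) ((6/11) + (25/33)*t) ((43740) + (-25286)*t) ((-6165) + (3552)*t) ((-148424248730208) + (85692779816688)*t) ((125533817618472) + (-72476983382868)*t) ((-169505593735212) + (97864100265642)*t) ((-956262336550497/2) + (552098317555539/2)*t) ((-824727561711525) + (476156679763059)*t) ((-986499871021431/2) + (569555966082339/2)*t) z w := by
  have e1 := aux_f2 t z w ht hw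
  have e2 := aux_g2 t z w ht hw
  have e3 := aux_h2 t z w ht hw
  have : w^6 * eval ![1 + z/w, 1/w] g = (w^2 * eval ![1 + z/w, 1/w] f2)^3
      + (w^2 * eval ![1 + z/w, 1/w] g2)^2 * (w^2 * eval ![1 + z/w, 1/w] h2) := by
    unfold g
    rw [map_add, map_mul, map_pow, map_pow]
    ring
  rw [this, e1, e2, mul_pow, mul_right_comm, e3, tsext]
  ring


lemma aux_g20 : eval ![2, 0] g ≠ 0 := by
  obtain ⟨t, ht⟩ : ∃ t : ℂ, t = ((Real.sqrt 3 : ℝ) : ℂ) := ⟨_, rfl⟩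
  have hs2 : t^2 = 3 := by rw [ht]; exact aux_sq
  have : eval ![2, 0] g = (-250797630729807) + (144798079608774)*t := by
    simp only [g, f2, g2, h2, x, y, s, map_add, map_sub, map_mul, map_pow, eval_X, eval_C, map_ofNat, map_neg, ← ht,
      Matrix.cons_val_zero, Matrix.cons_val_one, aux_dinv t ht]
    linear_combination ((-99540602191675091313/1472207)*t^0 + (123007108771866655980/1472207)*t^1 + (-117120264321960085617/2944414)*t^2)*hs2
  rw [this]
  exact aux_nz _ _ t hs2 (by norm_num)

lemma aux_g10 : eval ![1, 0] g = 0 := by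
  simp only [g, f2, g2, x, y, s, map_add, map_sub, map_mul, map_pow, eval_X, eval_C, map_ofNat,
    Matrix.cons_val_zero, Matrix.cons_val_one]
  ring

lemma aux_q {a0 a1 a2 a3 a4 a5 : ℂ} (P : MvPolynomial (Fin 2) ℂ)
    (h : P = C a0 + C a1 * X 0 + C a2 * X 1 + C a3 * (X 0 * X 0) + C a4 * (X 0 * X 1) + C a5 * (X 1 * X 1)) :
    P.totalDegree ≤ 2 := by
  have hX : ∀ i j : Fin 2, ∀ a : ℂ, (C a * (X i * X j)).totalDegree ≤ 2 := by
    intro i j a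
    refine (totalDegree_mul _ _).trans ?_
    rw [totalDegree_C, zero_add]
    refine (totalDegree_mul _ _).trans ?_
    rw [totalDegree_X, totalDegree_X]
  have hY : ∀ i : Fin 2, ∀ a : ℂ, (C a * X i).totalDegree ≤ 2 := by
    intro i a
    refine (totalDegree_mul _ _).trans ?_
    rw [totalDegree_C, zero_add, totalDegree_X]
    norm_num
  rw [h]
  refine (totalDegree_add _ _).trans (max_le ?_ (hX _ _ _))
  refine (totalDegree_add _ _).trans (max_le ?_ (hX _ _ _))
  refine (totalDegree_add _ _).trans (max_le ?_ (hX _ _ _))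
  refine (totalDegree_add _ _).trans (max_le ?_ (hY _ _))
  refine (totalDegree_add _ _).trans (max_le ?_ (hY _ _))
  simp

lemma aux_qf : f2.totalDegree ≤ 2 := by
  obtain ⟨t, ht⟩ : ∃ t : ℂ, t = ((Real.sqrt 3 : ℝ) : ℂ) := ⟨_, rfl⟩
  apply aux_q (a0 := 16962 - 9816*t) (a1 := -33924 + 19632*t) (a2 := 43740 - 25286*t)
    (a3 := 16962 - 9816*t) (a4 := 0) (a5 := 27445 - 15792*t)
  simp only [f2, x, y, s, ← ht, map_add, map_sub, map_mul, map_neg, map_ofNat, map_zero]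
  ring

lemma aux_qg : g2.totalDegree ≤ 2 := by
  obtain ⟨t, ht⟩ : ∃ t : ℂ, t = ((Real.sqrt 3 : ℝ) : ℂ) := ⟨_, rfl⟩
  apply aux_q (a0 := 6 + 9*t) (a1 := -12 - 18*t) (a2 := 3 + 16*t)
    (a3 := 6 + 9*t) (a4 := 0) (a5 := -38 - 11*t)
  simp only [g2, x, y, s, ← ht, map_add, map_sub, map_mul, map_neg, map_ofNat, map_zero]
  ring

lemma aux_qh : h2.totalDegree ≤ 2 := by
  obtain ⟨t, ht⟩ : ∃ t : ℂ, t = ((Real.sqrt 3 : ℝ) : ℂ) := ⟨_, rfl⟩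
  apply aux_q (a0 := -d⁻¹*(24984902205*t - 41386138293)) (a1 := -d⁻¹*(35951630964 - 23083475220*t))
    (a2 := -d⁻¹*(49893109990*t - 83905166058))
    (a3 := -d⁻¹*(80265133314*t - 136995863187)) (a4 := -d⁻¹*(36411797484 - 20817696276*t))
    (a5 := -d⁻¹*(23477770096*t - 45018774416))
  simp only [h2, x, y, s, ← ht, map_add, map_sub, map_mul, map_neg, map_ofNat, map_zero]
  ring

lemma aux_gdeg : g.totalDegree ≤ 6 := by
  unfold g
  have := aux_qf
  have := aux_qg
  have := aux_qh
  refine (totalDegree_add _ _).trans (max_le ?_ ?_)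
  · refine (totalDegree_pow _ _).trans ?_
    omega
  · refine (totalDegree_mul _ _).trans ?_
    have := totalDegree_pow g2 2
    omega

/-- `g` is irreducible and of non-torus type. -/
theorem g_irreducible_and_non_torus :
    Irreducible g ∧
      ¬ ∃ p q : MvPolynomial (Fin 2) ℂ,
        p.totalDegree ≤ 2 ∧ q.totalDegree ≤ 3 ∧ g = p ^ 3 + q ^ 2 := by
  obtain ⟨t, ht⟩ : ∃ t : ℂ, t = ((Real.sqrt 3 : ℝ) : ℂ) := ⟨_, rfl⟩
  have h2 : t^2 = 3 := by rw [ht]; exact aux_sq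
  have np : ((-6/11) + (-1/11)*t) ≠ 0 := aux_nz _ _ t h2 (by norm_num)
  have nm : ((-6165) + (3552)*t) ≠ 0 := aux_nz _ _ t h2 (by norm_num)
  have nh5 : ((-986499871021431/2) + (569555966082339/2)*t) ≠ 0 := aux_nz _ _ t h2 (by norm_num)
  have fac := aux_factor g ((-6/11) + (-1/11)*t) ((6/11) + (25/33)*t) ((43740) + (-25286)*t) ((-6165) + (3552)*t) ((-148424248730208) + (85692779816688)*t) ((125533817618472) + (-72476983382868)*t) ((-169505593735212) + (97864100265642)*t) ((-956262336550497/2) + (552098317555539/2)*t) ((-824727561711525) + (476156679763059)*t) ((-986499871021431/2) + (569555966082339/2)*t) np nm nh5 (aux_det t h2) (aux_g t ht) aux_g20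
  refine ⟨⟨?_, ?_⟩, ?_⟩
  · intro hu
    have := hu.map (eval ![1, 0])
    rw [aux_g10] at this
    simp at this
  · intro a b hab
    have hg0 : g ≠ 0 := by
      intro h
      apply aux_g20
      rw [h, map_zero]
    have ha : a ≠ 0 := by rintro rfl; simp [hab] at hg0
    have hb : b ≠ 0 := by rintro rfl; simp [hab] at hg0
    have hdeg := totalDegree_mul_of_isDomain ha hb
    rw [← hab] at hdeg
    have hd6 := aux_gdeg
    by_cases h3 : a.totalDegree ≤ 3
    · left; exact fac a b hab h3 (by omega)
    · right; exact fac b a (by rw [hab, mul_comm]) (by omega) (by omega)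
  · rintro ⟨a, b, ha, hb, hab⟩
    exact aux_nontorus g ((-6/11) + (-1/11)*t) ((6/11) + (25/33)*t) ((43740) + (-25286)*t) ((-6165) + (3552)*t) ((-148424248730208) + (85692779816688)*t) ((125533817618472) + (-72476983382868)*t) ((-169505593735212) + (97864100265642)*t) ((-956262336550497/2) + (552098317555539/2)*t) ((-824727561711525) + (476156679763059)*t) ((-986499871021431/2) + (569555966082339/2)*t) np nm nh5 (aux_minor t h2) (aux_g t ht) a b hab ha hb

end
end

section
/- Let f = 27800 + 7600y^5 - 15200y^3 + 86200x^3y^3 + 1650y^4x^2 + 15050x^6 - 3900y^2x^4 - 86200x^3y + 58000yx^4 + 58000yx^2 + 59650x^2 - 58600x + 7600y - 58600y^4x + 117200y^2x - 58000y^3x^2 - 40600yx^5 + 40600y^4 - 62000y^2 + 61900x^4 - 6400y^6 - 61300y^2x^2 - 65200x^3 - 6400y^3x + 3200yx + 65200y^2x^3 + 3200y^5x - 40600x^5, regarded as a polynomial in ℂ[x,y]. Then f is irreducible in ℂ[x,y], and there do not exist polynomials p, q ∈ ℂ[x,y] with total degree of p at most 2 and total degree of q at most 3 such that f = p^3 +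 q^2. -/
open MvPolynomial

noncomputable section

/-- The sextic of non-torus type with configuration `[3A_5]` (Method 1). -/
def f : MvPolynomial (Fin 2) ℂ :=
  27800 + 7600 * y ^ 5 - 15200 * y ^ 3 + 86200 * x ^ 3 * y ^ 3 + 1650 * y ^ 4 * x ^ 2
    + 15050 * x ^ 6 - 3900 * y ^ 2 * x ^ 4 - 86200 * x ^ 3 * y + 58000 * y * x ^ 4
    + 58000 * y * x ^ 2 + 59650 * x ^ 2 - 58600 * x + 7600 * y - 58600 * y ^ 4 * x
    + 117200 * y ^ 2 * x - 58000 * y ^ 3 * x ^ 2 - 40600 * y * x ^ 5 + 40600 * y ^ 4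
    - 62000 * y ^ 2 + 61900 * x ^ 4 - 6400 * y ^ 6 - 61300 * y ^ 2 * x ^ 2
    - 65200 * x ^ 3 - 6400 * y ^ 3 * x + 3200 * y * x + 65200 * y ^ 2 * x ^ 3
    + 3200 * y ^ 5 * x - 40600 * x ^ 5

theorem coefs7 {c0 c1 c2 c3 c4 c5 c6 : ℂ}
    (h : ∀ t : ℂ, c0 + c1 * t + c2 * t ^ 2 + c3 * t ^ 3 + c4 * t ^ 4 + c5 * t ^ 5 + c6 * t ^ 6 = 0) :
    c0 = 0 ∧ c1 = 0 ∧ c2 = 0 ∧ c3 = 0 ∧ c4 = 0 ∧ c5 = 0 ∧ c6 = 0 := by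
  have key : (Polynomial.C c0 + Polynomial.C c1 * Polynomial.X + Polynomial.C c2 * Polynomial.X ^ 2
      + Polynomial.C c3 * Polynomial.X ^ 3 + Polynomial.C c4 * Polynomial.X ^ 4
      + Polynomial.C c5 * Polynomial.X ^ 5 + Polynomial.C c6 * Polynomial.X ^ 6) = 0 := by
    apply Polynomial.funext
    intro t
    simpa using h t
  refine ⟨?_, ?_, ?_, ?_, ?_, ?_, ?_⟩
  · simpa [Polynomial.coeff_X, Polynomial.coeff_X_pow, Polynomial.coeff_C] using congrArg (fun p => Polynomial.coeff p 0) key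
  · simpa [Polynomial.coeff_X, Polynomial.coeff_X_pow, Polynomial.coeff_C] using congrArg (fun p => Polynomial.coeff p 1) key
  · simpa [Polynomial.coeff_X, Polynomial.coeff_X_pow, Polynomial.coeff_C] using congrArg (fun p => Polynomial.coeff p 2) key
  · simpa [Polynomial.coeff_X, Polynomial.coeff_X_pow, Polynomial.coeff_C] using congrArg (fun p => Polynomial.coeff p 3) key
  · simpa [Polynomial.coeff_X, Polynomial.coeff_X_pow, Polynomial.coeff_C] using congrArg (fun p => Polynomial.coeff p 4) key
  · simpa [Polynomial.coeff_X, Polynomial.coeff_X_pow, Polynomial.coeff_C] using congrArg (fun p => Polynomial.coeff p 5) key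
  · simpa [Polynomial.coeff_X, Polynomial.coeff_X_pow, Polynomial.coeff_C] using congrArg (fun p => Polynomial.coeff p 6) key

theorem eval_expand (p : MvPolynomial (Fin 2) ℂ) (n : ℕ) (hp : p.totalDegree ≤ n) :
    ∃ c : ℕ → ℕ → ℂ, (∀ i j, n < i + j → c i j = 0) ∧ ∀ u v : ℂ, eval ![u, v] p =
      ∑ i ∈ Finset.range (n + 1), ∑ j ∈ Finset.range (n + 1), c i j * u ^ i * v ^ j := by
  classical
  let m : ℕ × ℕ → (Fin 2 →₀ ℕ) := fun ij => Finsupp.single 0 ij.1 + Finsupp.single 1 ij.2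
  have hm0 : ∀ ij, m ij 0 = ij.1 := by intro ij; simp [m]
  have hm1 : ∀ ij, m ij 1 = ij.2 := by intro ij; simp [m]
  have hinj : Function.Injective m := by
    intro a b hab
    ext
    · rw [← hm0 a, ← hm0 b, hab]
    · rw [← hm1 a, ← hm1 b, hab]
  have hmm : ∀ d : Fin 2 →₀ ℕ, m (d 0, d 1) = d := by
    intro d
    ext k
    fin_cases k
    · exact hm0 _
    · exact hm1 _
  have hdeg : ∀ d ∈ p.support, d 0 + d 1 ≤ n := by
    intro d hd
    have := (le_totalDegree hd).trans hp
    rw [Finsupp.sum_fintype _ _ (by simp)] at this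
    simpa [Fin.sum_univ_two] using this
  refine ⟨fun i j => coeff (m (i, j)) p, ?_, ?_⟩
  · intro i j hij
    by_contra hne
    have := hdeg (m (i, j)) (mem_support_iff.mpr hne)
    rw [hm0, hm1] at this
    simp at this
    omega
  · intro u v
    rw [eval_eq', ← Finset.sum_product']
    have himg := Finset.sum_image (s := Finset.range (n+1) ×ˢ Finset.range (n+1)) (g := m)
      (f := fun d => coeff d p * u ^ (d 0) * v ^ (d 1)) (by intro a _ b _ h; exact hinj h)
    refine Eq.trans ?_ (himg.trans ?_)
    · apply Finset.sum_subset_zero_on_sdiff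
      · intro d hd
        rw [Finset.mem_image]
        refine ⟨(d 0, d 1), ?_, hmm d⟩
        have := hdeg d hd
        simp only [Finset.mem_product, Finset.mem_range]
        omega
      · intro d hd
        have : coeff d p = 0 := by
          have := (Finset.mem_sdiff.mp hd).2
          simpa using this
        simp [this]
      · intro d hd
        simp [Fin.prod_univ_two, mul_assoc]
    · apply Finset.sum_congr rfl
      intro a _
      rw [hm0, hm1]

theorem expand2 (p : MvPolynomial (Fin 2) ℂ) (hp : p.totalDegree ≤ 2) :
    ∃ p0 p1 p2 l0 l1 l2 : ℂ, ∀ u z : ℂ, eval ![u, z - 1] p =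
      (p0 + p1 * u + p2 * u ^ 2) + (l0 + l1 * u) * z + l2 * z ^ 2 := by
  obtain ⟨c, h0, hc⟩ := eval_expand p 2 hp
  refine ⟨c 0 0 - c 0 1 + c 0 2, c 1 0 - c 1 1, c 2 0, c 0 1 - 2 * c 0 2, c 1 1, c 0 2, ?_⟩
  intro u z
  rw [hc]
  simp [Finset.sum_range_succ, h0 1 2, h0 2 1, h0 2 2]
  ring

theorem expand3 (p : MvPolynomial (Fin 2) ℂ) (hp : p.totalDegree ≤ 3) :
    ∃ q0 q1 q2 q3 m0 m1 m3 m2 m4 m5 : ℂ, ∀ u z : ℂ, eval ![u, z - 1] p =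
      (q0 + q1 * u + q2 * u ^ 2 + q3 * u ^ 3) + (m0 + m1 * u + m3 * u ^ 2) * z
        + (m2 + m4 * u) * z ^ 2 + m5 * z ^ 3 := by
  obtain ⟨c, h0, hc⟩ := eval_expand p 3 hp
  refine ⟨c 0 0 - c 0 1 + c 0 2 - c 0 3, c 1 0 - c 1 1 + c 1 2, c 2 0 - c 2 1, c 3 0,
    c 0 1 - 2 * c 0 2 + 3 * c 0 3, c 1 1 - 2 * c 1 2, c 2 1, c 0 2 - 3 * c 0 3, c 1 2, c 0 3, ?_⟩
  intro u z
  rw [hc]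
  simp [Finset.sum_range_succ, h0 1 3, h0 2 2, h0 2 3, h0 3 1, h0 3 2, h0 3 3]
  ring

theorem eval_f (u z : ℂ) : eval ![u, z - 1] f = 50 * (301 * u ^ 6
    + (840 * u ^ 3 + 1316 * u ^ 4 - 812 * u ^ 5) * z
    + (1104 - 4944 * u + 2452 * u ^ 2 - 3868 * u ^ 3 - 78 * u ^ 4) * z ^ 2
    + (528 + 5200 * u - 1292 * u ^ 2 + 1724 * u ^ 3) * z ^ 3
    + (-1868 - 1492 * u + 33 * u ^ 2) * z ^ 4 + (920 + 64 * u) * z ^ 5 - 128 * z ^ 6) := by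
  simp [f, x, y]
  ring

theorem base_case {p0 p1 p2 q0 q1 q2 q3 : ℂ}
    (h : ∀ u : ℂ, (p0 + p1 * u + p2 * u ^ 2) ^ 3 + (q0 + q1 * u + q2 * u ^ 2 + q3 * u ^ 3) ^ 2
      = 15050 * u ^ 6) :
    p0 = 0 ∧ p1 = 0 ∧ q0 = 0 ∧ q1 = 0 ∧ q2 = 0 ∧ p2 ^ 3 + q3 ^ 2 = 15050 := by
  obtain ⟨e0, e1, e2, e3, e4, e5, e6⟩ := coefs7 (c0 := p0 ^ 3 + q0 ^ 2)
    (c1 := 3 * p0 ^ 2 * p1 + 2 * q0 * q1)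
    (c2 := 3 * p0 ^ 2 * p2 + 3 * p0 * p1 ^ 2 + 2 * q0 * q2 + q1 ^ 2)
    (c3 := p1 ^ 3 + 6 * p0 * p1 * p2 + 2 * q0 * q3 + 2 * q1 * q2)
    (c4 := 3 * p0 * p2 ^ 2 + 3 * p1 ^ 2 * p2 + 2 * q1 * q3 + q2 ^ 2)
    (c5 := 3 * p1 * p2 ^ 2 + 2 * q2 * q3)
    (c6 := p2 ^ 3 + q3 ^ 2 - 15050)
    (fun t => by linear_combination h t)
  by_cases hp : p0 = 0
  · subst hp
    have hq0 : q0 = 0 := by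
      have : q0 ^ 2 = 0 := by linear_combination e0
      exact pow_eq_zero_iff (two_ne_zero) |>.mp this
    subst hq0
    have hq1 : q1 = 0 := by
      have : q1 ^ 2 = 0 := by linear_combination e2
      exact pow_eq_zero_iff (two_ne_zero) |>.mp this
    subst hq1
    have hp1 : p1 = 0 := by
      have : p1 ^ 3 = 0 := by linear_combination e3
      exact pow_eq_zero_iff (three_ne_zero) |>.mp this
    subst hp1
    have hq2 : q2 = 0 := by
      have : q2 ^ 2 = 0 := by linear_combination e4
      exact pow_eq_zero_iff (two_ne_zero) |>.mp this
    exact ⟨rfl, rfl, rfl, rfl, hq2, by linear_combination e6⟩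
  · exfalso
    obtain ⟨s, hs⟩ : ∃ s, s = - q0 / p0 := ⟨_, rfl⟩
    have hq : q0 = - s * p0 := by rw [hs]; field_simp
    have hp0 : p0 = - s ^ 2 := by
      have : p0 ^ 2 * (p0 + s ^ 2) = 0 := by rw [hq] at e0; linear_combination e0
      have := (mul_eq_zero.mp this).resolve_left (pow_ne_zero _ hp)
      linear_combination this
    have hs0 : s ≠ 0 := by rintro rfl; apply hp; rw [hp0]; ring
    subst hp0
    have hq0 : q0 = s ^ 3 := by rw [hq]; ring
    subst hq0
    -- p1 = s ^ 2 a, p2 = s ^ 2 b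
    obtain ⟨a, ha⟩ : ∃ a, p1 = s ^ 2 * a := ⟨p1 / s ^ 2, by field_simp⟩
    obtain ⟨b, hb⟩ : ∃ b, p2 = s ^ 2 * b := ⟨p2 / s ^ 2, by field_simp⟩
    subst ha hb
    have c3 : s ^ 3 ≠ 0 := pow_ne_zero _ hs0
    have hq1 : q1 = - 3 / 2 * a * s ^ 3 := by
      apply mul_left_cancel₀ c3
      linear_combination e1 / 2
    subst hq1
    have hq2 : q2 = s ^ 3 * (3 / 8 * a ^ 2 - 3 / 2 * b) := by
      apply mul_left_cancel₀ c3
      linear_combination e2 / 2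
    subst hq2
    have hq3 : q3 = s ^ 3 * (1 / 16 * a ^ 3 + 3 / 4 * a * b) := by
      apply mul_left_cancel₀ c3
      linear_combination e3 / 2
    subst hq3
    have hb : b = - a ^ 2 / 4 := by
      have : s ^ 6 * (b + a ^ 2 / 4) ^ 2 = 0 := by linear_combination (-4/3) * e4
      have := (mul_eq_zero.mp this).resolve_left (pow_ne_zero _ hs0)
      have := pow_eq_zero_iff (two_ne_zero) |>.mp this
      linear_combination this
    subst hb
    have : (15050 : ℂ) = 0 := by linear_combination -e6
    norm_num at this

theorem non_torus (p q : MvPolynomial (Fin 2) ℂ) (hp : p.totalDegree ≤ 2) (hq : q.totalDegree ≤ 3)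
    (h : f = p ^ 3 + q ^ 2) : False := by
  obtain ⟨p0, p1, p2, l0, l1, l2, hp⟩ := expand2 p hp
  obtain ⟨q0, q1, q2, q3, m0, m1, m3, m2, m4, m5, hq⟩ := expand3 q hq
  have H : ∀ u z : ℂ, _ := fun u z => eval_f u z
  simp only [h, map_add, map_pow, hp, hq] at H
  obtain ⟨rfl, rfl, rfl, rfl, rfl, e60⟩ := base_case (p0 := p0) (p1 := p1) (p2 := p2)
    (q0 := q0) (q1 := q1) (q2 := q2) (q3 := q3) (fun u => by linear_combination H u 0)
  have H2 := fun u : ℂ => coefs7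
    (c0 := p2 ^ 3 * u ^ 6 + q3 ^ 2 * u ^ 6 - 50 * 301 * u ^ 6)
    (c1 := 3 * p2 ^ 2 * u ^ 4 * (l0 + l1 * u) + 2 * q3 * u ^ 3 * (m0 + m1 * u + m3 * u ^ 2)
      - 50 * (840 * u ^ 3 + 1316 * u ^ 4 - 812 * u ^ 5))
    (c2 := 3 * p2 ^ 2 * u ^ 4 * l2 + 3 * p2 * u ^ 2 * (l0 + l1 * u) ^ 2
      + (m0 + m1 * u + m3 * u ^ 2) ^ 2 + 2 * q3 * u ^ 3 * (m2 + m4 * u)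
      - 50 * (1104 - 4944 * u + 2452 * u ^ 2 - 3868 * u ^ 3 - 78 * u ^ 4))
    (c3 := (l0 + l1 * u) ^ 3 + 6 * p2 * u ^ 2 * (l0 + l1 * u) * l2
      + 2 * q3 * u ^ 3 * m5 + 2 * (m0 + m1 * u + m3 * u ^ 2) * (m2 + m4 * u)
      - 50 * (528 + 5200 * u - 1292 * u ^ 2 + 1724 * u ^ 3))
    (c4 := 3 * p2 * u ^ 2 * l2 ^ 2 + 3 * (l0 + l1 * u) ^ 2 * l2 + (m2 + m4 * u) ^ 2
      + 2 * (m0 + m1 * u + m3 * u ^ 2) * m5 - 50 * (-1868 - 1492 * u + 33 * u ^ 2))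
    (c5 := 3 * (l0 + l1 * u) * l2 ^ 2 + 2 * (m2 + m4 * u) * m5 - 50 * (920 + 64 * u))
    (c6 := l2 ^ 3 + m5 ^ 2 + 50 * 128)
    (fun z => by linear_combination H u z)
  obtain ⟨-, -, -, e31, e41, e51, -⟩ := coefs7 (c0 := 0) (c1 := 0) (c2 := 0)
    (c3 := 2 * q3 * m0 - 50 * 840) (c4 := 3 * p2 ^ 2 * l0 + 2 * q3 * m1 - 50 * 1316)
    (c5 := 3 * p2 ^ 2 * l1 + 2 * q3 * m3 + 50 * 812) (c6 := 0)
    (fun u => by linear_combination (H2 u).2.1)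
  obtain ⟨e02, e12, e22, e32, -, -, -⟩ := coefs7 (c0 := m0 ^ 2 - 50 * 1104)
    (c1 := 2 * m0 * m1 + 50 * 4944) (c2 := 3 * p2 * l0 ^ 2 + m1 ^ 2 + 2 * m0 * m3 - 50 * 2452)
    (c3 := 6 * p2 * l0 * l1 + 2 * m1 * m3 + 2 * q3 * m2 + 50 * 3868)
    (c4 := 3 * p2 ^ 2 * l2 + 3 * p2 * l1 ^ 2 + m3 ^ 2 + 2 * q3 * m4 + 50 * 78)
    (c5 := 0) (c6 := 0) (fun u => by linear_combination (H2 u).2.2.1)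
  have e03 : l0 ^ 3 + 2 * m0 * m2 - 50 * 528 = 0 := by
    linear_combination (H2 0).2.2.2.1
  have hm0 : m0 ≠ 0 := by rintro rfl; norm_num at e02
  have hq3 : q3 = 420 / 1104 * m0 := by
    apply mul_left_cancel₀ hm0
    linear_combination e31 / 2 - 420 / 1104 * e02
  subst hq3
  have hp2 : p2 ^ 3 = 50 * (3248 / 23) := by
    linear_combination e60 - (420/1104)^2 * e02
  have hp0 : p2 ≠ 0 := by rintro rfl; norm_num at hp2
  have hm1 : m1 = -2472 / 1104 * m0 := by
    apply mul_left_cancel₀ hm0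
    linear_combination e12 / 2 + 2472 / 1104 * e02
  subst hm1
  have hl0 : l0 = 1313 / 174 * p2 := by
    apply mul_left_cancel₀ (pow_ne_zero 2 hp0)
    linear_combination e41 / 3 + (2/3) * (420 / 1104) * (2472/1104) * e02 - 1313 / 174 * hp2
  subst hl0
  have hm3 : m3 = -27220238 / 2001 / 1104 * m0 := by
    apply mul_left_cancel₀ hm0
    linear_combination e22 / 2 - (2472/1104)^2/2 * e02 + 27220238 / 2001 / 1104 * e02
      - 3 / 2 * (1313/174) ^ 2 * hp2
  subst hm3
  have hl1 : l1 = 62711927/2785392 * p2 := by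
    apply mul_left_cancel₀ (pow_ne_zero 2 hp0)
    linear_combination e51 / 3 + (2/3) * (420 / 1104) * (27220238 / 2001 /1104) * e02
      - 62711927/2785392 * hp2
  subst hl1
  have hm2 : m2 = -15707122175/522261 / 1104 * m0 := by
    apply mul_left_cancel₀ hm0
    linear_combination e03 / 2 - (1313 / 174) ^ 3 / 2 * hp2 + 15707122175/522261 / 1104 * e02
  subst hm2
  have : (50 * (4465010821733/24024006) : ℂ) = 0 := by
    linear_combination e32 - 6 * (1313 / 174) * (62711927/2785392) * hp2
      - (2 * (2472 / 1104) * (27220238 / 2001 / 1104)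
        - 2 * (420 / 1104) * (15707122175/522261 / 1104)) * e02
  norm_num at this

/-- difference of squares version of the 3+3 factorization -/
theorem no_cubics (S T : MvPolynomial (Fin 2) ℂ) (hS : S.totalDegree ≤ 3) (hT : T.totalDegree ≤ 3)
    (h : S ^ 2 - T ^ 2 = C 15050 * f) (hS0 : ∀ u, eval ![u, -1] S = 15050 * u ^ 3)
    (hT0 : ∀ u, eval ![u, -1] T = 0) : False := by
  obtain ⟨q0, q1, q2, q3, m0, m1, m3, m2, m4, m5, hS⟩ := expand3 S hS
  obtain ⟨r0, r1, r2, r3, n0, n1, n3, n2, n4, n5, hT⟩ := expand3 T hT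
  obtain ⟨rfl, rfl, rfl, e, -, -, -⟩ := coefs7 (c0 := q0) (c1 := q1) (c2 := q2)
    (c3 := q3 - 15050) (c4 := 0) (c5 := 0) (c6 := 0) (fun u => by
      have h1 := hS u 0
      have h2 := hS0 u
      rw [zero_sub] at h1
      linear_combination h2 - h1)
  obtain rfl : q3 = 15050 := by linear_combination e
  obtain ⟨rfl, rfl, rfl, rfl, -, -, -⟩ := coefs7 (c0 := r0) (c1 := r1) (c2 := r2)
    (c3 := r3) (c4 := 0) (c5 := 0) (c6 := 0) (fun u => by
      have h1 := hT u 0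
      have h2 := hT0 u
      rw [zero_sub] at h1
      linear_combination h2 - h1)
  have H : ∀ u z : ℂ, _ := fun u z => congrArg (eval ![u, z - 1]) h
  simp only [map_sub, map_mul, map_pow, hS, hT, eval_f, eval_C] at H
  have H2 := fun u : ℂ => coefs7 (c0 := 0)
    (c1 := 2 * 15050 * u ^ 3 * (m0 + m1 * u + m3 * u ^ 2)
      - 15050 * 50 * (840 * u ^ 3 + 1316 * u ^ 4 - 812 * u ^ 5))
    (c2 := (m0 + m1 * u + m3 * u ^ 2) ^ 2 + 2 * 15050 * u ^ 3 * (m2 + m4 * u)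
      - (n0 + n1 * u + n3 * u ^ 2) ^ 2
      - 15050 * 50 * (1104 - 4944 * u + 2452 * u ^ 2 - 3868 * u ^ 3 - 78 * u ^ 4))
    (c3 := 2 * 15050 * u ^ 3 * m5 + 2 * (m0 + m1 * u + m3 * u ^ 2) * (m2 + m4 * u)
      - 2 * (n0 + n1 * u + n3 * u ^ 2) * (n2 + n4 * u)
      - 15050 * 50 * (528 + 5200 * u - 1292 * u ^ 2 + 1724 * u ^ 3))
    (c4 := (m2 + m4 * u) ^ 2 + 2 * (m0 + m1 * u + m3 * u ^ 2) * m5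
      - (n2 + n4 * u) ^ 2 - 2 * (n0 + n1 * u + n3 * u ^ 2) * n5
      - 15050 * 50 * (-1868 - 1492 * u + 33 * u ^ 2))
    (c5 := 2 * (m2 + m4 * u) * m5 - 2 * (n2 + n4 * u) * n5 - 15050 * 50 * (920 + 64 * u))
    (c6 := m5 ^ 2 - n5 ^ 2 + 15050 * 50 * 128)
    (fun z => by linear_combination H u z)
  obtain ⟨-, -, -, e31, e41, e51, -⟩ := coefs7 (c0 := 0) (c1 := 0) (c2 := 0)
    (c3 := 2 * m0 - 50 * 840) (c4 := 2 * m1 - 50 * 1316) (c5 := 2 * m3 + 50 * 812) (c6 := 0)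
    (fun u => by linear_combination (H2 u).2.1 / 15050)
  obtain ⟨e02, e12, e22, e32, e42, -, -⟩ := coefs7
    (c0 := m0 ^ 2 - n0 ^ 2 - 15050 * 50 * 1104)
    (c1 := 2 * m0 * m1 - 2 * n0 * n1 + 15050 * 50 * 4944)
    (c2 := m1 ^ 2 + 2 * m0 * m3 - n1 ^ 2 - 2 * n0 * n3 - 15050 * 50 * 2452)
    (c3 := 2 * m1 * m3 + 2 * 15050 * m2 - 2 * n1 * n3 + 15050 * 50 * 3868)
    (c4 := m3 ^ 2 + 2 * 15050 * m4 - n3 ^ 2 + 15050 * 50 * 78)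
    (c5 := 0) (c6 := 0) (fun u => by linear_combination (H2 u).2.2.1)
  obtain ⟨e03, e13, e23, -, -, -, -⟩ := coefs7
    (c0 := 2 * m0 * m2 - 2 * n0 * n2 - 15050 * 50 * 528)
    (c1 := 2 * m0 * m4 + 2 * m1 * m2 - 2 * n0 * n4 - 2 * n1 * n2 - 15050 * 50 * 5200)
    (c2 := 2 * m1 * m4 + 2 * m3 * m2 - 2 * n1 * n4 - 2 * n3 * n2 + 15050 * 50 * 1292)
    (c3 := 2 * 15050 * m5 + 2 * m3 * m4 - 2 * n3 * n4 - 15050 * 50 * 1724)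
    (c4 := 0) (c5 := 0) (c6 := 0) (fun u => by linear_combination (H2 u).2.2.2.1)
  clear H2 H hS hT h hS0 hT0
  obtain rfl : m0 = 15050 * (60 / 43) := by linear_combination e31 / 2
  obtain rfl : m1 = 15050 * (94 / 43) := by linear_combination e41 / 2
  obtain rfl : m3 = 15050 * (-58 / 43) := by linear_combination e51 / 2
  have hD : n0 ^ 2 = 15050 ^ 2 * (-22272/12943) := by linear_combination -e02
  have hn0 : n0 ≠ 0 := by rintro rfl; norm_num at hD
  obtain rfl : n1 = -3037/464 * n0 := by
    apply mul_left_cancel₀ hn0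
    linear_combination -e12 / 2 + 3037/464 * hD
  obtain rfl : n3 = -8331097/430592 * n0 := by
    apply mul_left_cancel₀ hn0
    linear_combination -e22 / 2 + (8331097/430592 - (3037/464)^2 / 2) * hD
  obtain rfl : m2 = 15050 * (-256198043/1157216) := by
    linear_combination e32 / 30100 + (3037/464) * (8331097/430592) * 2 / 30100 * hD
  obtain rfl : m4 = 15050 * (-693997977599/2147792896) := by
    linear_combination e42 / 30100 + (8331097/430592) ^ 2 / 30100 * hD
  obtain rfl : n2 = 8992390257/49948672 * n0 := by
    apply mul_left_cancel₀ hn0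
    linear_combination -e03 / 2 - 8992390257/49948672 * hD
  obtain rfl : n4 = 160068286820273/92704735232 * n0 := by
    apply mul_left_cancel₀ hn0
    linear_combination -e13 / 2 - (160068286820273/92704735232
      - 3037/464 * (8992390257/49948672)) * hD
  have : (15050 ^ 2 * (-6439525676987625/124571987968) : ℂ) = 0 := by
    linear_combination e23 + (2 * (-3037/464) * (160068286820273/92704735232)
      + 2 * (-8331097/430592) * (8992390257/49948672)) * hD
  norm_num at this

/-- restriction to the line y = -1 -/
def phi : MvPolynomial (Fin 2) ℂ →ₐ[ℂ] Polynomial ℂ := aeval ![Polynomial.X, -1]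

theorem phi_f : phi f = Polynomial.C 15050 * Polynomial.X ^ 6 := by
  apply Polynomial.funext
  intro t
  simp [phi, f, x, y]
  ring

theorem pd_num (k : ℕ) [k.AtLeastTwo] :
    pderiv 1 (ofNat(k) : MvPolynomial (Fin 2) ℂ) = 0 := by
  have : (ofNat(k) : MvPolynomial (Fin 2) ℂ) = C (ofNat(k)) := (map_ofNat C k).symm
  rw [this, pderiv_C]

theorem phi_f1 : phi (pderiv 1 f) = Polynomial.X ^ 3 * (Polynomial.C 42000 +
    Polynomial.C 65800 * Polynomial.X - Polynomial.C 40600 * Polynomial.X ^ 2) := by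
  apply Polynomial.funext
  intro t
  simp [phi, f, x, y, pd_num, pderiv_X, Derivation.leibniz, Derivation.leibniz_pow]
  ring

theorem phi_f2 : (phi (pderiv 1 (pderiv 1 f))).eval 0 = 110400 := by
  simp [phi, f, x, y, pd_num, pderiv_X, Derivation.leibniz, Derivation.leibniz_pow]
  norm_num

theorem phi_eval (p : MvPolynomial (Fin 2) ℂ) (u : ℂ) : (phi p).eval u = eval ![u, -1] p := by
  have : ((Polynomial.aeval u).comp phi) = aeval ![u, -1] := by
    apply algHom_ext
    intro i
    fin_cases i <;> simp [phi]
  have := congrArg (fun g => g p) this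
  simpa [Polynomial.aeval_def, Polynomial.eval₂_eq_eval_map, aeval_eq_eval] using this

theorem phi_deg (p : MvPolynomial (Fin 2) ℂ) : (phi p).natDegree ≤ p.totalDegree := by
  have := aeval_natDegree_le p (m := p.totalDegree) (n := 1) le_rfl ![Polynomial.X, -1] (by
    intro i
    fin_cases i <;> simp)
  simpa [phi] using this

theorem excl (a b : MvPolynomial (Fin 2) ℂ) (h : f = a * b) (α β : ℂ) (i j : ℕ) (hα : α ≠ 0)
    (ha : phi a = Polynomial.C α * Polynomial.X ^ i) (hb : phi b = Polynomial.C β * Polynomial.X ^ j)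
    (hi : 1 ≤ i) (hi2 : i ≤ 2) (hij : i < j) : False := by
  have h1 := phi_f1
  have h2 := phi_f2
  rw [h] at h1 h2
  simp only [Derivation.leibniz, map_add, smul_eq_mul, map_mul, ha, hb] at h1 h2
  have hb1 : (phi (pderiv 1 b)).eval 0 = 0 := by
    have : Polynomial.X ^ (i + 1) ∣ Polynomial.X ^ i * (Polynomial.C α * phi (pderiv 1 b)) := by
      have e : Polynomial.X ^ i * (Polynomial.C α * phi (pderiv 1 b)) =
        Polynomial.X ^ 3 * (Polynomial.C 42000 +
          Polynomial.C 65800 * Polynomial.X - Polynomial.C 40600 * Polynomial.X ^ 2)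
          - Polynomial.X ^ j * (Polynomial.C β * phi (pderiv 1 a)) := by
        linear_combination h1
      rw [e]
      exact dvd_sub ((pow_dvd_pow _ (by omega)).mul_right _) ((pow_dvd_pow _ (by omega)).mul_right _)
    rw [pow_succ] at this
    have := (mul_dvd_mul_iff_left (pow_ne_zero i Polynomial.X_ne_zero)).mp this
    rw [Polynomial.X_dvd_iff, Polynomial.coeff_zero_eq_eval_zero] at this
    simpa [hα] using this
  have hi0 : i ≠ 0 := by omega
  have hj0 : j ≠ 0 := by omega
  simp [hb1, hi0, hj0] at h2

theorem divisor_form (g : Polynomial ℂ) (h : g ∣ Polynomial.C 15050 * Polynomial.X ^ 6) :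
    ∃ (α : ℂ) (i : ℕ), α ≠ 0 ∧ g = Polynomial.C α * Polynomial.X ^ i := by
  have hu : IsUnit (Polynomial.C (15050 : ℂ)) := by
    rw [Polynomial.isUnit_C]; exact isUnit_iff_ne_zero.mpr (by norm_num)
  rw [hu.dvd_mul_left] at h
  obtain ⟨i, -, hi⟩ := (dvd_prime_pow Polynomial.prime_X 6).mp h
  obtain ⟨w, hw⟩ := hi.symm
  obtain ⟨α, hα, hα'⟩ := Polynomial.isUnit_iff.mp w.isUnit
  refine ⟨α, i, hα.ne_zero, ?_⟩
  rw [← hw, ← hα', mul_comm]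

theorem dg_num (k : ℕ) [k.AtLeastTwo] :
    (ofNat(k) : MvPolynomial (Fin 2) ℂ).totalDegree ≤ 0 := by
  have : (ofNat(k) : MvPolynomial (Fin 2) ℂ) = C (ofNat(k)) := (map_ofNat C k).symm
  rw [this, totalDegree_C]

theorem dg_mul {a b : MvPolynomial (Fin 2) ℂ} {m k : ℕ} (ha : a.totalDegree ≤ m)
    (hb : b.totalDegree ≤ k) : (a * b).totalDegree ≤ m + k :=
  (totalDegree_mul _ _).trans (add_le_add ha hb)

theorem dg_x (k : ℕ) : (x ^ k).totalDegree ≤ k := by simp [x]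

theorem dg_y (k : ℕ) : (y ^ k).totalDegree ≤ k := by simp [y]

theorem dg_x1 : x.totalDegree ≤ 1 := by simp [x]

theorem dg_y1 : y.totalDegree ≤ 1 := by simp [y]

theorem dg_bnd {a : MvPolynomial (Fin 2) ℂ} {m : ℕ} (ha : a.totalDegree ≤ m)
    (hm : m ≤ 6) : a.totalDegree ≤ 6 := ha.trans hm

theorem f_deg : f.totalDegree ≤ 6 := by
  have hadd : ∀ {a b : MvPolynomial (Fin 2) ℂ}, a.totalDegree ≤ 6 → b.totalDegree ≤ 6 →
      (a + b).totalDegree ≤ 6 := fun ha hb => (totalDegree_add _ _).trans (max_le ha hb)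
  have hsub : ∀ {a b : MvPolynomial (Fin 2) ℂ}, a.totalDegree ≤ 6 → b.totalDegree ≤ 6 →
      (a - b).totalDegree ≤ 6 := fun ha hb => (totalDegree_sub _ _).trans (max_le ha hb)
  unfold f
  repeat' with_reducible first | apply hadd | apply hsub
  all_goals
    apply dg_bnd
    · repeat' with_reducible first
        | apply dg_mul
        | exact dg_x1 | exact dg_y1 | exact dg_x _ | exact dg_y _ | exact dg_num _
    · norm_num

theorem unit_of_deg (a : MvPolynomial (Fin 2) ℂ) (h0 : a ≠ 0) (h : a.totalDegree = 0) : IsUnit a := by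
  rw [totalDegree_eq_zero_iff_eq_C] at h
  rw [h]
  apply IsUnit.map
  apply isUnit_iff_ne_zero.mpr
  intro hc
  rw [hc] at h
  exact h0 (by simpa using h)

theorem f_irred : Irreducible f := by
  have hf0 : f ≠ 0 := by
    intro h
    have := phi_f
    rw [h] at this
    have := congrArg (Polynomial.eval 1) this
    simp at this
  have hfphi := phi_f
  refine ⟨?_, ?_⟩
  · intro hu
    have := hu.map phi
    rw [phi_f] at this
    have := Polynomial.natDegree_eq_zero_of_isUnit this
    rw [Polynomial.natDegree_C_mul_X_pow _ _ (by norm_num)] at this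
    omega
  · intro a b hab
    have ha0 : a ≠ 0 := by rintro rfl; simp at hab; exact hf0 hab
    have hb0 : b ≠ 0 := by rintro rfl; simp at hab; exact hf0 hab
    have hd : a.totalDegree + b.totalDegree ≤ 6 := by
      rw [← totalDegree_mul_of_isDomain ha0 hb0, ← hab]; exact f_deg
    have hmul : phi a * phi b = Polynomial.C 15050 * Polynomial.X ^ 6 := by
      rw [← map_mul, ← hab, phi_f]
    obtain ⟨α, i, hα, ha⟩ := divisor_form (phi a) ⟨_, hmul.symm⟩
    obtain ⟨β, j, hβ, hb⟩ := divisor_form (phi b) ⟨phi a, by rw [← hmul, mul_comm]⟩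
    have hai := phi_deg a
    have hbj := phi_deg b
    rw [ha, Polynomial.natDegree_C_mul_X_pow _ _ hα] at hai
    rw [hb, Polynomial.natDegree_C_mul_X_pow _ _ hβ] at hbj
    have hmul' : Polynomial.C (α * β) * Polynomial.X ^ (i + j) = Polynomial.C 15050 * Polynomial.X ^ 6 := by
      rw [← hmul, ha, hb, Polynomial.C_mul, pow_add]; ring
    have hij : i + j = 6 := by
      have := congrArg Polynomial.natDegree hmul'
      rwa [Polynomial.natDegree_C_mul_X_pow _ _ (mul_ne_zero hα hβ),
        Polynomial.natDegree_C_mul_X_pow _ _ (by norm_num)] at this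
    have hαβ : α * β = 15050 := by
      have := congrArg (Polynomial.eval 1) hmul'
      simpa using this
    by_cases hi0 : i = 0
    · left; exact unit_of_deg a ha0 (by omega)
    by_cases hj0 : j = 0
    · right; exact unit_of_deg b hb0 (by omega)
    exfalso
    rcases lt_trichotomy i j with hlt | heq | hlt
    · exact excl a b hab α β i j hα ha hb (by omega) (by omega) hlt
    · obtain rfl : i = 3 := by omega
      obtain rfl : j = 3 := by omega
      have hA : ∀ u, eval ![u, -1] a = α * u ^ 3 := by
        intro u; rw [← phi_eval, ha]; simp
      have hB : ∀ u, eval ![u, -1] b = β * u ^ 3 := by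
        intro u; rw [← phi_eval, hb]; simp
      have dg : ∀ s t : ℂ, (C s * a + C t * b).totalDegree ≤ 3 := by
        intro s t
        refine (totalDegree_add _ _).trans (max_le ?_ ?_)
        · refine (totalDegree_mul _ _).trans ?_
          rw [totalDegree_C]; omega
        · refine (totalDegree_mul _ _).trans ?_
          rw [totalDegree_C]; omega
      refine no_cubics (C (β / 2) * a + C (α / 2) * b) (C (β / 2) * a + C (-α / 2) * b)
        (dg _ _) (dg _ _) ?_ ?_ ?_
      · have e1 : (C (15050 : ℂ) : MvPolynomial (Fin 2) ℂ) = 4 * C (α / 2) * C (β / 2) := by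
          rw [← hαβ, show (4 : MvPolynomial (Fin 2) ℂ) = C 4 from (map_ofNat C 4).symm, ← C_mul, ← C_mul]
          congr 1; ring
        have e2 : (C (-α / 2) : MvPolynomial (Fin 2) ℂ) = - C (α / 2) := by
          rw [← C_neg]; congr 1; ring
        rw [e1, e2, hab]; ring
      · intro u
        simp [hA, hB]
        linear_combination u ^ 3 * hαβ
      · intro u
        simp [hA, hB]
        ring
    · exact excl b a (by rw [hab, mul_comm]) β α j i hβ hb ha (by omega) (by omega) hlt

/-- `f` is irreducible and of non-torus type. -/
theorem f_irreducible_and_non_torus :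
    Irreducible f ∧
      ¬ ∃ p q : MvPolynomial (Fin 2) ℂ,
        p.totalDegree ≤ 2 ∧ q.totalDegree ≤ 3 ∧ f = p ^ 3 + q ^ 2 := by
  refine ⟨f_irred, ?_⟩
  rintro ⟨p, q, hp, hq, h⟩
  exact non_torus p q hp hq h

end
end
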